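/- arXiv:1904.10305 — 2 statements merged into one kernel-verified Lean document; each statement's English description precedes it below -/
import Mathlib

section
/- Let E_1 and E_2 be 3-dimensional Volterra evolution algebras over ℝ with structural matrices A_1 = [[0, a_1, −b_1], [−a_1, 0, c_1], [b_1, −c_1, 0]] and A_2 = [[0, a_2, −b_2], [−a_2, 0, c_2], [b_2, −c_2, 0]], where all entries lie in [−1, 1], a_2 b_2 c_2 ≠ 0, and a_1, b_1, c_1 are nonzero and all of the same sign. If E_1 ≅ E_2, then neither of the associated Volterra quadratic stochastic operators V_{A_1}, V_{A_2} on S^2 is ergodic. -/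
open Matrix Filter

/-- The product in the evolution algebra (on `Fin n → ℝ`) whose structural matrix,
relative to the natural basis of coordinate vectors, is `A`. -/
def evolMul {n : ℕ} (A : Matrix (Fin n) (Fin n) ℝ)
    (x y : Fin n → ℝ) : Fin n → ℝ :=
  fun k => ∑ i, x i * y i * A i k

/-- The Volterra quadratic stochastic operator associated with the skew-symmetric
matrix `A`: `(V_A x)_k = x_k (1 + ∑ i, a_{ki} x_i)`. -/
def volterraQSO {m : ℕ} (A : Matrix (Fin m) (Fin m) ℝ) (x : Fin m → ℝ) : Fin m → ℝ :=
  fun k => x k * (1 + ∑ i, A k i * x i)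

/-- `V` is ergodic: the Cesàro averages `(1/n) ∑_{k=0}^{n-1} V^k(x)` converge for every
point `x` of the simplex. -/
def IsErgodic {m : ℕ} (V : (Fin m → ℝ) → (Fin m → ℝ)) : Prop :=
  ∀ x : Fin m → ℝ, (∀ i, 0 ≤ x i) → (∑ i, x i = 1) →
    ∃ L : Fin m → ℝ,
      Tendsto (fun N : ℕ => (N : ℝ)⁻¹ • ∑ k ∈ Finset.range N, V^[k] x) atTop (nhds L)

open scoped Topology

/-- The Cesàro averages of `u` converge to `L`. -/
def CesaroTendsto (u : ℕ → ℝ) (L : ℝ) : Prop :=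
  Tendsto (fun N : ℕ => (N : ℝ)⁻¹ * ∑ k ∈ Finset.range N, u k) atTop (𝓝 L)

/-- An interior orbit, in coordinates, of the Volterra operator with matrix
`[[0,a,-b],[-a,0,c],[b,-c,0]]`. -/
structure IsCyclicOrbit (a b c : ℝ) (x y z : ℕ → ℝ) : Prop where
  pos_x : ∀ n, 0 < x n
  pos_y : ∀ n, 0 < y n
  pos_z : ∀ n, 0 < z n
  sum_eq : ∀ n, x n + y n + z n = 1
  step_x : ∀ n, x (n + 1) = x n * (1 + a * y n - b * z n)
  step_y : ∀ n, y (n + 1) = y n * (1 + c * z n - a * x n)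
  step_z : ∀ n, z (n + 1) = z n * (1 + b * x n - c * y n)

lemma IsCyclicOrbit.rotate {a b c : ℝ} {x y z : ℕ → ℝ} (h : IsCyclicOrbit a b c x y z) :
    IsCyclicOrbit c a b y z x :=
  ⟨h.pos_y, h.pos_z, h.pos_x, fun n => by linarith [h.sum_eq n], h.step_y, h.step_z, h.step_x⟩

lemma CesaroTendsto.eventually_lt_sum {u : ℕ → ℝ} {L r : ℝ} (h : CesaroTendsto u L)
    (hr : r < L) : ∀ᶠ N : ℕ in atTop, r * N < ∑ k ∈ Finset.range N, u k := by
  filter_upwards [h.eventually_const_lt hr, eventually_gt_atTop 0] with N hN h0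
  have h0' : (0 : ℝ) < N := by exact_mod_cast h0
  rwa [inv_mul_eq_div, lt_div_iff₀ h0'] at hN

lemma CesaroTendsto.eventually_sum_lt {u : ℕ → ℝ} {L r : ℝ} (h : CesaroTendsto u L)
    (hr : L < r) : ∀ᶠ N : ℕ in atTop, ∑ k ∈ Finset.range N, u k < r * N := by
  filter_upwards [h.eventually_lt_const hr, eventually_gt_atTop 0] with N hN h0
  have h0' : (0 : ℝ) < N := by exact_mod_cast h0
  rwa [inv_mul_eq_div, div_lt_iff₀ h0'] at hN

lemma CesaroTendsto.nonneg {u : ℕ → ℝ} {L : ℝ} (h : CesaroTendsto u L) (hu : ∀ n, 0 < u n) :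
    0 ≤ L :=
  ge_of_tendsto' h fun N =>
    mul_nonneg (by positivity) (Finset.sum_nonneg fun k _ => (hu k).le)

lemma CesaroTendsto.linearComb {u v : ℕ → ℝ} {L M : ℝ} (hu : CesaroTendsto u L)
    (hv : CesaroTendsto v M) (a b : ℝ) :
    CesaroTendsto (fun n => a * u n + b * v n) (a * L + b * M) := by
  refine ((hu.const_mul a).add (hv.const_mul b)).congr fun N => ?_
  rw [Finset.sum_add_distrib, ← Finset.mul_sum, ← Finset.mul_sum]
  ring

lemma CesaroTendsto.sum_eq_one {u v w : ℕ → ℝ} {L M K : ℝ} (hu : CesaroTendsto u L)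
    (hv : CesaroTendsto v M) (hw : CesaroTendsto w K) (h : ∀ n, u n + v n + w n = 1) :
    L + M + K = 1 := by
  refine tendsto_nhds_unique ((hu.add hv).add hw) (tendsto_const_nhds.congr' ?_)
  filter_upwards [eventually_gt_atTop 0] with N h0
  have h0' : (N : ℝ) ≠ 0 := by exact_mod_cast h0.ne'
  rw [← mul_add, ← mul_add, ← Finset.sum_add_distrib, ← Finset.sum_add_distrib]
  simp [h, h0']

lemma CesaroTendsto.pos_of_eventually_ge {u : ℕ → ℝ} {L ε : ℝ} (h : CesaroTendsto u L)
    (hu : ∀ n, 0 < u n) (hε : 0 < ε) (hge : ∀ᶠ n in atTop, ε ≤ u n) : 0 < L := by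
  by_contra! hL
  obtain ⟨N, hN⟩ := eventually_atTop.1 hge
  obtain ⟨n, hn, hnN⟩ := ((h.eventually_sum_lt (r := ε / 2) (by linarith)).and
    (eventually_ge_atTop (2 * N))).exists
  have hsplit := Finset.sum_range_add_sum_Ico u (show N ≤ n by lia)
  have h1 : 0 ≤ ∑ k ∈ Finset.range N, u k := Finset.sum_nonneg fun k _ => (hu k).le
  have h2 := Finset.card_nsmul_le_sum (Finset.Ico N n) u ε
    fun k hk => hN k (Finset.mem_Ico.1 hk).1
  rw [Nat.card_Ico, nsmul_eq_mul, Nat.cast_sub (by lia)] at h2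
  have h3 : (2 * N : ℝ) ≤ n := by exact_mod_cast hnN
  nlinarith

/-- A positive sequence that at most doubles at each step and has positive Cesàro limit
does not become exponentially small. -/
lemma CesaroTendsto.eventually_exp_lt {u : ℕ → ℝ} {L δ : ℝ} (h : CesaroTendsto u L)
    (hu : ∀ n, 0 < u n) (hdouble : ∀ n, u (n + 1) ≤ 2 * u n) (hL : 0 < L) (hδ : 0 < δ) :
    ∀ᶠ n : ℕ in atTop, Real.exp (-(δ * n)) < u n := by
  wlog hδ1 : δ ≤ 1 generalizing δ
  · filter_upwards [this one_pos le_rfl] with n hn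
    refine lt_of_le_of_lt (Real.exp_le_exp.2 ?_) hn
    have : (0 : ℝ) ≤ n := n.cast_nonneg
    nlinarith
  have hpow : ∀ N j, u (N + j) ≤ 2 ^ j * u N := by
    intro N j
    induction j with
    | zero => simp
    | succ j ih =>
      calc u (N + (j + 1)) ≤ 2 * u (N + j) := hdouble _
        _ ≤ 2 * (2 ^ j * u N) := by linarith
        _ = 2 ^ (j + 1) * u N := by ring
  have hsum : ∀ N j, ∑ k ∈ Finset.range (N + j), u k ≤
      ∑ k ∈ Finset.range N, u k + (2 ^ j - 1) * u N := by
    intro N j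
    induction j with
    | zero => simp
    | succ j ih =>
      rw [← add_assoc, Finset.sum_range_succ, pow_succ]
      linarith [hpow N j]
  set ε := L * δ / 8 with hε
  have hε0 : 0 < ε := by positivity
  obtain ⟨N₀, hN₀⟩ := eventually_atTop.1 (h.eventually_lt_sum (r := L - ε) (by linarith))
  filter_upwards [h.eventually_sum_lt (r := L + ε) (by linarith), eventually_ge_atTop N₀,
    (tendsto_natCast_atTop_atTop (R := ℝ)).eventually_gt_atTop (2 * (1 + L) / (L * δ))]
    with N hN hNN hbig
  by_contra! hsmall
  have hδN : 0 ≤ δ * N := by positivity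
  set j := ⌊δ * N⌋₊ with hj
  have hj1 : (j : ℝ) ≤ δ * N := Nat.floor_le hδN
  have hj2 : δ * N < j + 1 := Nat.lt_floor_add_one _
  have h2j : (2 : ℝ) ^ j * u N ≤ 1 := by
    have h2e : (2 : ℝ) ≤ Real.exp 1 := by linarith [Real.add_one_le_exp 1]
    calc (2 : ℝ) ^ j * u N ≤ Real.exp 1 ^ j * Real.exp (-(δ * N)) :=
          mul_le_mul (pow_le_pow_left₀ (by norm_num) h2e j) hsmall (hu N).le (by positivity)
      _ = Real.exp (j - δ * N) := by
          rw [← Real.exp_nat_mul, ← Real.exp_add]; ring_nf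
      _ ≤ 1 := Real.exp_le_one_iff.2 (by linarith)
  have h1 := hN₀ (N + j) (by lia)
  push_cast at h1
  have h2 := hsum N j
  have h3 := hu N
  rw [div_lt_iff₀ (by positivity)] at hbig
  have hεL : ε ≤ L / 8 := by rw [hε]; nlinarith
  have h4 : (δ * N - 1) * (L - ε) ≤ j * (L - ε) :=
    mul_le_mul_of_nonneg_right (by linarith) (by linarith)
  have h5 : δ * N * (7 * L / 8) ≤ δ * N * (L - ε) :=
    mul_le_mul_of_nonneg_left (by linarith) hδN
  have h6 : ε * N = L * δ * N / 8 := by rw [hε]; ring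
  nlinarith

lemma eventually_ge_of_summable {x y : ℕ → ℝ} (hx : ∀ n, 0 < x n) (hy : ∀ n, 0 < y n)
    (hx1 : ∀ n, x n < 1) (hs : Summable x) (hstep : ∀ n, y n * (1 - x n) ≤ y (n + 1)) :
    ∃ ε > 0, ∀ᶠ n in atTop, ε ≤ y n := by
  obtain ⟨N, hN⟩ := ((tendsto_sum_nat_add x).eventually_lt_const
    (show (0 : ℝ) < 1 / 2 by norm_num)).exists
  have hs' := (summable_nat_add_iff N).2 hs
  have key : ∀ m, y N * (1 - ∑ k ∈ Finset.range m, x (k + N)) ≤ y (N + m) := by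
    intro m
    induction m with
    | zero => simp
    | succ m ih =>
      have h1 := hstep (N + m)
      have h2 := mul_le_mul_of_nonneg_right ih (sub_nonneg.2 (hx1 (N + m)).le)
      have h3 : 0 ≤ ∑ k ∈ Finset.range m, x (k + N) := Finset.sum_nonneg fun k _ => (hx _).le
      have h4 := mul_nonneg (mul_nonneg (hy N).le h3) (hx (N + m)).le
      rw [Finset.sum_range_succ, add_comm m N, ← add_assoc]
      nlinarith
  refine ⟨y N / 2, half_pos (hy N), ?_⟩
  filter_upwards [eventually_ge_atTop N] with n hn
  obtain ⟨m, rfl⟩ := Nat.exists_eq_add_of_le hn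
  have h1 := hs'.sum_le_tsum (Finset.range m) fun k _ => (hx _).le
  nlinarith [key m, hy N]

lemma summable_of_growth_neg {x t : ℕ → ℝ} {r : ℝ} (hx : ∀ n, 0 < x n)
    (hstep : ∀ n, x (n + 1) = x n * (1 + t n)) (ht : CesaroTendsto t r) (hr : r < 0) :
    Summable x := by
  have hle : ∀ n, x n ≤ x 0 * Real.exp (∑ k ∈ Finset.range n, t k) := by
    intro n
    induction n with
    | zero => simp
    | succ n ih =>
      rw [Finset.sum_range_succ, Real.exp_add, hstep, ← mul_assoc]
      have h1 := mul_le_mul_of_nonneg_left (Real.add_one_le_exp (t n)) (hx n).le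
      have h2 := mul_le_mul_of_nonneg_right ih (Real.exp_pos (t n)).le
      linarith
  have hgeom : Summable fun n : ℕ => x 0 * Real.exp (n * (r / 2)) :=
    (Real.summable_exp_nat_mul_iff.2 (by linarith)).mul_left _
  refine hgeom.of_norm_bounded_eventually_nat ?_
  filter_upwards [ht.eventually_sum_lt (r := r / 2) (by linarith)] with n hn
  rw [Real.norm_of_nonneg (hx n).le]
  refine (hle n).trans (mul_le_mul_of_nonneg_left (Real.exp_le_exp.2 ?_) (hx 0).le)
  linarith

lemma Real.log_one_add_le_sub_sq_div {t : ℝ} (h0 : -1 < t) (h1 : t ≤ 1) :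
    Real.log (1 + t) ≤ t - t ^ 2 / 9 := by
  obtain ⟨s, hs, rfl⟩ : ∃ s : ℝ, 0 < s ∧ t = s ^ 2 - 1 :=
    ⟨√(1 + t), Real.sqrt_pos.2 (by linarith), by rw [Real.sq_sqrt (by linarith)]; ring⟩
  have h2 : Real.log s ≤ s - 1 := Real.log_le_sub_one_of_pos hs
  have h3 : s ≤ 2 := by nlinarith
  rw [add_sub_cancel, Real.log_pow]
  have h4 : 0 ≤ (s - 1) ^ 2 * (9 - (s + 1) ^ 2) := mul_nonneg (sq_nonneg _) (by nlinarith)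
  push_cast
  nlinarith

namespace IsCyclicOrbit

variable {a b c : ℝ} {x y z : ℕ → ℝ}

lemma limit_pos_of_growth_neg (h : IsCyclicOrbit a b c x y z) (ha1 : a ≤ 1)
    (hc : 0 < c) {M K : ℝ} (hy : CesaroTendsto y M)
    (hz : CesaroTendsto z K) (hneg : a * M - b * K < 0) : 0 < M := by
  have hs : Summable x := by
    refine summable_of_growth_neg h.pos_x (t := fun n => a * y n + -b * z n) (fun n => ?_)
      (hy.linearComb hz a (-b)) (by linarith)
    rw [h.step_x]; ring
  obtain ⟨ε, hε, hge⟩ := eventually_ge_of_summable h.pos_x h.pos_y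
    (fun n => by linarith [h.sum_eq n, h.pos_y n, h.pos_z n]) hs fun n => by
      rw [h.step_y]
      refine mul_le_mul_of_nonneg_left ?_ (h.pos_y n).le
      nlinarith [h.pos_x n, mul_pos hc (h.pos_z n)]
  exact hy.pos_of_eventually_ge h.pos_y hε hge

lemma step_x_le (h : IsCyclicOrbit a b c x y z) (ha1 : a ≤ 1) (hb : 0 < b) (n : ℕ) :
    x (n + 1) ≤ 2 * x n := by
  rw [h.step_x]
  nlinarith [h.pos_x n, h.pos_y n, mul_pos hb (h.pos_z n), h.sum_eq n, h.pos_z n,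
    mul_pos (h.pos_x n) (h.pos_y n), mul_pos (h.pos_x n) (mul_pos hb (h.pos_z n))]

lemma log_step_le (h : IsCyclicOrbit a b c x y z) (ha : 0 < a) (hb : 0 < b) (ha1 : a ≤ 1)
    (hb1 : b ≤ 1) (n : ℕ) :
    Real.log (x (n + 1)) ≤
      Real.log (x n) + (a * y n - b * z n) - (a * y n - b * z n) ^ 2 / 9 := by
  have hx := h.pos_x n
  have hy := h.pos_y n
  have hz := h.pos_z n
  have hs := h.sum_eq n
  have h1 : -1 < a * y n - b * z n := by nlinarith
  have h2 : a * y n - b * z n ≤ 1 := by nlinarith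
  rw [h.step_x, add_sub_assoc, Real.log_mul hx.ne' (by linarith)]
  linarith [Real.log_one_add_le_sub_sq_div h1 h2]

/-- Logarithm of the Lyapunov function `x ^ c * y ^ b * z ^ a`, at a point. -/
noncomputable def logLyapunov (a b c x y z : ℝ) : ℝ :=
  c * Real.log x + b * Real.log y + a * Real.log z

lemma sq_drop_le {a b c x y z : ℝ} (ha : 0 < a) (hb : 0 < b) (hc : 0 < c) (ha1 : a ≤ 1)
    (hb1 : b ≤ 1) (hs : x + y + z = 1) (hx : x < c / (2 * (a + b + c))) :
    (a * b * c) ^ 2 / 8 ≤ b * (c * z - a * x) ^ 2 + a * (b * x - c * y) ^ 2 := by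
  rw [lt_div_iff₀ (by positivity)] at hx
  set p := c * z - a * x
  set q := b * x - c * y
  have hpq : q - p < -(c / 2) := by
    have : q - p = (a + b + c) * x - c * (x + y + z) := by ring
    rw [this, hs]; linarith
  have h1 : c ^ 2 / 8 ≤ p ^ 2 + q ^ 2 := by nlinarith [sq_nonneg (p + q)]
  have hab : a * b ≤ 1 := by nlinarith
  have hab0 : 0 < a * b := by positivity
  calc (a * b * c) ^ 2 / 8 = (a * b) * ((a * b) * (c ^ 2 / 8)) := by ring
    _ ≤ (a * b) * (1 * (c ^ 2 / 8)) := by gcongr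
    _ ≤ (a * b) * (p ^ 2 + q ^ 2) := by rw [one_mul]; gcongr
    _ ≤ b * p ^ 2 + a * q ^ 2 := by
      nlinarith [mul_nonneg (mul_nonneg hb.le (sub_nonneg.2 ha1)) (sq_nonneg p),
        mul_nonneg (mul_nonneg ha.le (sub_nonneg.2 hb1)) (sq_nonneg q)]

lemma logLyapunov_succ_le (h : IsCyclicOrbit a b c x y z) (ha : 0 < a) (hb : 0 < b)
    (hc : 0 < c) (ha1 : a ≤ 1) (hb1 : b ≤ 1) (hc1 : c ≤ 1) (n : ℕ)
    (hlt : logLyapunov a b c (x n) (y n) (z n) <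
      logLyapunov a b c (c / (2 * (a + b + c))) (b / (2 * (a + b + c))) (a / (2 * (a + b + c)))) :
    logLyapunov a b c (x (n + 1)) (y (n + 1)) (z (n + 1)) ≤
      logLyapunov a b c (x n) (y n) (z n) - (a * b * c) ^ 2 / 72 := by
  have hdrop : (a * b * c) ^ 2 / 8 ≤ c * (a * y n - b * z n) ^ 2 +
      b * (c * z n - a * x n) ^ 2 + a * (b * x n - c * y n) ^ 2 := by
    have hs := h.sum_eq n
    by_cases hx : x n < c / (2 * (a + b + c))
    · have := sq_drop_le ha hb hc ha1 hb1 hs hx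
      have : 0 ≤ c * (a * y n - b * z n) ^ 2 := by positivity
      linarith
    by_cases hy : y n < b / (2 * (a + b + c))
    · have h1 := sq_drop_le (x := y n) (y := z n) (z := x n) hc ha hb hc1 ha1 (by linarith)
        (by rwa [show c + a + b = a + b + c by ring])
      have : 0 ≤ b * (c * z n - a * x n) ^ 2 := by positivity
      rw [show c * a * b = a * b * c by ring] at h1
      linarith
    by_cases hz : z n < a / (2 * (a + b + c))
    · have h1 := sq_drop_le (x := z n) (y := x n) (z := y n) hb hc ha hb1 hc1 (by linarith)
        (by rwa [show b + c + a = a + b + c by ring])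
      have : 0 ≤ a * (b * x n - c * y n) ^ 2 := by positivity
      rw [show b * c * a = a * b * c by ring] at h1
      linarith
    push Not at hx hy hz
    refine absurd hlt (not_lt.2 ?_)
    unfold logLyapunov
    gcongr
  have h1 := mul_le_mul_of_nonneg_left (h.log_step_le ha hb ha1 hb1 n) hc.le
  have h2 := mul_le_mul_of_nonneg_left (h.rotate.log_step_le hc ha hc1 ha1 n) hb.le
  have h3 := mul_le_mul_of_nonneg_left (h.rotate.rotate.log_step_le hb hc hb1 hc1 n) ha.le
  unfold logLyapunov
  linarith

/-- Along an orbit starting below a suitable level of the Lyapunov function, some coordinate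
is exponentially small at every time. -/
lemma exists_coord_le_exp (h : IsCyclicOrbit a b c x y z) (ha : 0 < a) (hb : 0 < b)
    (hc : 0 < c) (ha1 : a ≤ 1) (hb1 : b ≤ 1) (hc1 : c ≤ 1)
    (hlt : logLyapunov a b c (x 0) (y 0) (z 0) <
      logLyapunov a b c (c / (2 * (a + b + c))) (b / (2 * (a + b + c))) (a / (2 * (a + b + c)))) :
    ∃ δ > 0, ∀ n : ℕ, x n ≤ Real.exp (-(δ * n)) ∨ y n ≤ Real.exp (-(δ * n)) ∨
      z n ≤ Real.exp (-(δ * n)) := by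
  have hδ : 0 < (a * b * c) ^ 2 / 72 := by positivity
  have key : ∀ n : ℕ, logLyapunov a b c (x n) (y n) (z n) ≤
      logLyapunov a b c (x 0) (y 0) (z 0) - (a * b * c) ^ 2 / 72 * n := by
    intro n
    induction n with
    | zero => simp
    | succ n ih =>
      have h0 : 0 ≤ (a * b * c) ^ 2 / 72 * n := by positivity
      have h1 := h.logLyapunov_succ_le ha hb hc ha1 hb1 hc1 n (by linarith)
      push_cast
      linarith
  have hx1 : ∀ n, Real.log (x n) ≤ 0 := fun n => Real.log_nonpos (h.pos_x n).le
    (by linarith [h.sum_eq n, h.pos_y n, h.pos_z n])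
  have hy1 : ∀ n, Real.log (y n) ≤ 0 := fun n => Real.log_nonpos (h.pos_y n).le
    (by linarith [h.sum_eq n, h.pos_x n, h.pos_z n])
  have hz1 : ∀ n, Real.log (z n) ≤ 0 := fun n => Real.log_nonpos (h.pos_z n).le
    (by linarith [h.sum_eq n, h.pos_y n, h.pos_x n])
  refine ⟨(a * b * c) ^ 2 / 72 / 3, by positivity, fun n => ?_⟩
  by_contra! hcon
  obtain ⟨h1, h2, h3⟩ := hcon
  rw [← Real.lt_log_iff_exp_lt (h.pos_x n)] at h1
  rw [← Real.lt_log_iff_exp_lt (h.pos_y n)] at h2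
  rw [← Real.lt_log_iff_exp_lt (h.pos_z n)] at h3
  have hk := key n
  unfold logLyapunov at hk
  nlinarith [hx1 n, hy1 n, hz1 n, hx1 0, hy1 0, hz1 0, mul_nonpos_of_nonneg_of_nonpos hc.le (hx1 0),
    mul_nonpos_of_nonneg_of_nonpos hb.le (hy1 0), mul_nonpos_of_nonneg_of_nonpos ha.le (hz1 0),
    mul_nonpos_of_nonneg_of_nonpos (sub_nonneg.2 hc1) (hx1 n),
    mul_nonpos_of_nonneg_of_nonpos (sub_nonneg.2 hb1) (hy1 n),
    mul_nonpos_of_nonneg_of_nonpos (sub_nonneg.2 ha1) (hz1 n)]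

lemma limit_ne_zero (h : IsCyclicOrbit a b c x y z) (hb : 0 < b)
    (hc : 0 < c) (ha1 : a ≤ 1) (hb1 : b ≤ 1) {L M K : ℝ}
    (hx : CesaroTendsto x L) (hy : CesaroTendsto y M) (hz : CesaroTendsto z K) (ha : 0 < a) :
    L ≠ 0 := by
  rintro rfl
  have hsum := hx.sum_eq_one hy hz h.sum_eq
  rcases (hy.nonneg h.pos_y).eq_or_lt with hM | hM
  · have := h.limit_pos_of_growth_neg ha1 hc hy hz (by subst hM; nlinarith)
    exact this.ne hM
  · exact (h.rotate.rotate.limit_pos_of_growth_neg hb1 ha hx hy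
      (by nlinarith)).false

theorem not_cesaroTendsto (h : IsCyclicOrbit a b c x y z) (ha : 0 < a) (hb : 0 < b)
    (hc : 0 < c) (ha1 : a ≤ 1) (hb1 : b ≤ 1) (hc1 : c ≤ 1)
    (hlt : logLyapunov a b c (x 0) (y 0) (z 0) <
      logLyapunov a b c (c / (2 * (a + b + c))) (b / (2 * (a + b + c))) (a / (2 * (a + b + c))))
    {L M K : ℝ} (hx : CesaroTendsto x L) (hy : CesaroTendsto y M) (hz : CesaroTendsto z K) :
    False := by
  obtain ⟨δ, hδ, hsmall⟩ := h.exists_coord_le_exp ha hb hc ha1 hb1 hc1 hlt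
  have hL := (hx.nonneg h.pos_x).lt_of_ne' (h.limit_ne_zero hb hc ha1 hb1 hx hy hz ha)
  have hM := (hy.nonneg h.pos_y).lt_of_ne'
    (h.rotate.limit_ne_zero ha hb hc1 ha1 hy hz hx hc)
  have hK := (hz.nonneg h.pos_z).lt_of_ne'
    (h.rotate.rotate.limit_ne_zero hc ha hb1 hc1 hz hx hy hb)
  obtain ⟨n, h1, h2, h3⟩ := ((hx.eventually_exp_lt h.pos_x (h.step_x_le ha1 hb) hL hδ).and
    ((hy.eventually_exp_lt h.pos_y (h.rotate.step_x_le hc1 ha) hM hδ).and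
    (hz.eventually_exp_lt h.pos_z (h.rotate.rotate.step_x_le hb1 hc) hK hδ))).exists
  rcases hsmall n with h' | h' | h' <;> linarith

end IsCyclicOrbit

lemma exists_simplex_logLyapunov_lt {a b c : ℝ} (ha : 0 < a) (hb : 0 < b) (hc : 0 < c) (M : ℝ) :
    ∃ p q r : ℝ, 0 < p ∧ 0 < q ∧ 0 < r ∧ p + q + r = 1 ∧
      IsCyclicOrbit.logLyapunov a b c p q r < M := by
  obtain ⟨ε, hε, hε0, hε1⟩ := ((Real.tendsto_log_nhdsGT_zero.eventually_lt_atBot (M / c)).and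
    (Ioo_mem_nhdsGT (show (0 : ℝ) < 1 / 4 by norm_num))).exists
  refine ⟨ε, ε, 1 - 2 * ε, hε0, hε0, by linarith, by ring, ?_⟩
  rw [lt_div_iff₀ hc] at hε
  have h1 : Real.log ε ≤ 0 := Real.log_nonpos hε0.le (by linarith)
  have h2 : Real.log (1 - 2 * ε) ≤ 0 := Real.log_nonpos (by linarith) (by linarith)
  unfold IsCyclicOrbit.logLyapunov
  nlinarith

lemma isCyclicOrbit_of_step {a b c : ℝ} (ha : 0 < a) (hb : 0 < b) (hc : 0 < c) (ha1 : a ≤ 1)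
    (hb1 : b ≤ 1) (hc1 : c ≤ 1) {x y z : ℕ → ℝ} (hx : 0 < x 0) (hy : 0 < y 0) (hz : 0 < z 0)
    (hs : x 0 + y 0 + z 0 = 1)
    (step_x : ∀ n, x (n + 1) = x n * (1 + a * y n - b * z n))
    (step_y : ∀ n, y (n + 1) = y n * (1 + c * z n - a * x n))
    (step_z : ∀ n, z (n + 1) = z n * (1 + b * x n - c * y n)) :
    IsCyclicOrbit a b c x y z := by
  have key : ∀ n, 0 < x n ∧ 0 < y n ∧ 0 < z n ∧ x n + y n + z n = 1 := by
    intro n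
    induction n with
    | zero => exact ⟨hx, hy, hz, hs⟩
    | succ n ih =>
      obtain ⟨h1, h2, h3, h4⟩ := ih
      rw [step_x, step_y, step_z]
      refine ⟨mul_pos h1 ?_, mul_pos h2 ?_, mul_pos h3 ?_, ?_⟩
      · nlinarith [mul_pos ha h2]
      · nlinarith [mul_pos hc h3]
      · nlinarith [mul_pos hb h1]
      · linear_combination h4
  exact ⟨fun n => (key n).1, fun n => (key n).2.1, fun n => (key n).2.2.1,
    fun n => (key n).2.2.2, step_x, step_y, step_z⟩

lemma cesaroTendsto_apply {V : (Fin 3 → ℝ) → Fin 3 → ℝ} {p L : Fin 3 → ℝ}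
    (h : Tendsto (fun N : ℕ => (N : ℝ)⁻¹ • ∑ k ∈ Finset.range N, V^[k] p) atTop (nhds L))
    (i : Fin 3) : CesaroTendsto (fun n => V^[n] p i) (L i) := by
  refine ((tendsto_pi_nhds.1 h) i).congr fun N => ?_
  simp [Finset.sum_apply]

theorem not_isErgodic_volterraQSO_of_pos {a b c : ℝ} (ha : 0 < a) (hb : 0 < b) (hc : 0 < c)
    (ha1 : a ≤ 1) (hb1 : b ≤ 1) (hc1 : c ≤ 1) :
    ¬ IsErgodic (volterraQSO !![0, a, -b; -a, 0, c; b, -c, 0]) := by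
  intro herg
  obtain ⟨p, q, r, hp, hq, hr, hs, hlt⟩ := exists_simplex_logLyapunov_lt ha hb hc
    (IsCyclicOrbit.logLyapunov a b c
      (c / (2 * (a + b + c))) (b / (2 * (a + b + c))) (a / (2 * (a + b + c))))
  obtain ⟨L, hL⟩ := herg ![p, q, r] (by simp [Fin.forall_fin_succ, hp.le, hq.le, hr.le])
    (by simpa [Fin.sum_univ_three] using hs)
  refine (isCyclicOrbit_of_step ha hb hc ha1 hb1 hc1 (by simpa) (by simpa) (by simpa) (by simpa)
    ?_ ?_ ?_).not_cesaroTendsto ha hb hc ha1 hb1 hc1 (by simpa)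
    (cesaroTendsto_apply hL 0) (cesaroTendsto_apply hL 1) (cesaroTendsto_apply hL 2) <;>
  · intro n
    simp only [Function.iterate_succ_apply']
    simp [volterraQSO, Fin.sum_univ_three]
    ring_nf
    simp

theorem not_isErgodic_volterraQSO_of_neg {a b c : ℝ} (ha : a < 0) (hb : b < 0) (hc : c < 0)
    (ha1 : -1 ≤ a) (hb1 : -1 ≤ b) (hc1 : -1 ≤ c) :
    ¬ IsErgodic (volterraQSO !![0, a, -b; -a, 0, c; b, -c, 0]) := by
  intro herg
  rw [← neg_pos] at ha hb hc
  rw [neg_le] at ha1 hb1 hc1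
  obtain ⟨p, q, r, hp, hq, hr, hs, hlt⟩ := exists_simplex_logLyapunov_lt hb ha hc
    (IsCyclicOrbit.logLyapunov (-b) (-a) (-c)
      (-c / (2 * (-b + -a + -c))) (-a / (2 * (-b + -a + -c))) (-b / (2 * (-b + -a + -c))))
  obtain ⟨L, hL⟩ := herg ![p, r, q] (by simp [Fin.forall_fin_succ, hp.le, hq.le, hr.le])
    (by simp [Fin.sum_univ_three]; linarith)
  refine (isCyclicOrbit_of_step hb ha hc hb1 ha1 hc1 (by simpa) (by simpa) (by simpa) (by simpa)
    ?_ ?_ ?_).not_cesaroTendsto hb ha hc hb1 ha1 hc1 (by simpa)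
    (cesaroTendsto_apply hL 0) (cesaroTendsto_apply hL 2) (cesaroTendsto_apply hL 1) <;>
  · intro n
    simp only [Function.iterate_succ_apply']
    simp [volterraQSO, Fin.sum_univ_three]
    ring_nf
    simp

lemma mul_pos_of_sq_mul_eq {α β A B t : ℝ} (s u : ℝ) (hαβ : 0 < α * β) (ht : t ≠ 0)
    (hA : s ^ 2 * A = α * t) (hB : u ^ 2 * B = β * t) : 0 < A * B := by
  have h1 : 0 < (s ^ 2 * u ^ 2) * (A * B) := by
    have : (s ^ 2 * u ^ 2) * (A * B) = (α * β) * t ^ 2 := by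
      linear_combination u ^ 2 * B * hA + α * t * hB
    rw [this]; positivity
  exact pos_of_mul_pos_right h1 (by positivity)

/-- If three nonzero vectors have pairwise coordinatewise products proportional to `w`, and two
of the vectors have overlapping supports, then the entries of `w` have the same sign. -/
lemma mul_pos_of_overlap {w p q r : Fin 3 → ℝ} (hw : ∀ k, w k ≠ 0)
    (hpq : ∀ k l, w k * (p l * q l) = w l * (p k * q k))
    (hpr : ∀ k l, w k * (p l * r l) = w l * (p k * r k))
    (hqr : ∀ k l, w k * (q l * r l) = w l * (q k * r k)) (hr : r ≠ 0)
    {k : Fin 3} (hk : p k * q k ≠ 0) (i j : Fin 3) : 0 < w i * w j := by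
  have full : ∀ {u v : Fin 3 → ℝ}, (∀ k l, w k * (u l * v l) = w l * (u k * v k)) →
      ∀ {k}, u k * v k ≠ 0 → ∀ l, u l * v l ≠ 0 := by
    intro u v h k hk l hl
    have := h k l
    rw [hl, mul_zero] at this
    exact mul_ne_zero (hw l) hk this.symm
  have hpq' := full hpq hk
  obtain ⟨m, hm⟩ := Function.ne_iff.1 hr
  have hpr' := full hpr (mul_ne_zero (left_ne_zero_of_mul (hpq' m)) hm)
  have hpos : ∀ l, 0 < (p l * q l * r l) ^ 2 := fun l =>
    sq_pos_of_ne_zero (mul_ne_zero (hpq' l) (right_ne_zero_of_mul (hpr' l)))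
  have hcube : w i ^ 3 * (p j * q j * r j) ^ 2 = w j ^ 3 * (p i * q i * r i) ^ 2 := by
    calc w i ^ 3 * (p j * q j * r j) ^ 2
        = (w i * (p j * q j)) * (w i * (p j * r j)) * (w i * (q j * r j)) := by ring
      _ = (w j * (p i * q i)) * (w j * (p i * r i)) * (w j * (q i * r i)) := by
        rw [hpq, hpr, hqr]
      _ = w j ^ 3 * (p i * q i * r i) ^ 2 := by ring
  have h1 : 0 < (p j * q j * r j) ^ 2 * (w i ^ 2 * (w i * w j)) := by
    have : (p j * q j * r j) ^ 2 * (w i ^ 2 * (w i * w j)) =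
        (w j ^ 2) ^ 2 * (p i * q i * r i) ^ 2 := by linear_combination w j * hcube
    rw [this]
    have := hpos i
    have := hw j
    positivity
  exact pos_of_mul_pos_right (pos_of_mul_pos_right h1 (hpos j).le) (sq_nonneg _)

/-- An isomorphism onto a Volterra evolution algebra with nonzero off-diagonal coefficients
carries the cyclic sign pattern over. -/
lemma sign_pattern_of_iso {a₁ b₁ c₁ a₂ b₂ c₂ : ℝ} (h₂ : a₂ * b₂ * c₂ ≠ 0)
    (hab : 0 < a₁ * b₁) (hbc : 0 < b₁ * c₁)
    (ψ : (Fin 3 → ℝ) ≃ₗ[ℝ] (Fin 3 → ℝ))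
    (hψ : ∀ x y : Fin 3 → ℝ,
      ψ (evolMul !![0, a₁, -b₁; -a₁, 0, c₁; b₁, -c₁, 0] x y) =
        evolMul !![0, a₂, -b₂; -a₂, 0, c₂; b₂, -c₂, 0] (ψ x) (ψ y)) :
    0 < a₂ * b₂ ∧ 0 < b₂ * c₂ := by
  obtain ⟨⟨ha, hb⟩, hc⟩ : (a₂ ≠ 0 ∧ b₂ ≠ 0) ∧ c₂ ≠ 0 := by simpa [mul_ne_zero_iff] using h₂
  set M : Matrix (Fin 3) (Fin 3) ℝ := !![0, a₂, -b₂; -a₂, 0, c₂; b₂, -c₂, 0] with hM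
  set w : Fin 3 → ℝ := ![c₂, b₂, a₂] with hw
  set e : Fin 3 → Fin 3 → ℝ := fun i => Pi.single i 1 with he
  have hne : ∀ i, ψ (e i) ≠ 0 := fun i => by simp [he]
  have hprod : ∀ i j, i ≠ j → ∀ k l,
      w k * (ψ (e i) l * ψ (e j) l) = w l * (ψ (e i) k * ψ (e j) k) := by
    intro i j hij
    have hzero : evolMul !![0, a₁, -b₁; -a₁, 0, c₁; b₁, -c₁, 0] (e i) (e j) = 0 := by
      funext k
      refine Finset.sum_eq_zero fun m _ => ?_
      by_cases hm : m = i
      · subst hm; simp [he, hij]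
      · simp [he, hm]
    have h := hψ (e i) (e j)
    rw [hzero, map_zero] at h
    have h0 := congrFun h 0
    have h1 := congrFun h 1
    have h2 := congrFun h 2
    simp [evolMul, hM, Fin.sum_univ_three] at h0 h1 h2
    intro k l
    fin_cases k <;> fin_cases l <;> simp [hw] <;> linarith
  have h0 : ∀ l, ∑ k, ψ (e 0) k * ψ (e 0) k * M k l = a₁ * ψ (e 1) l - b₁ * ψ (e 2) l := by
    intro l
    have hsq : evolMul !![0, a₁, -b₁; -a₁, 0, c₁; b₁, -c₁, 0] (e 0) (e 0) =
        a₁ • e 1 - b₁ • e 2 := by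
      funext k; fin_cases k <;> simp [evolMul, he, Fin.sum_univ_three]
    have h := hψ (e 0) (e 0)
    rw [hsq] at h
    simpa [evolMul] using (congrFun h l).symm
  have h1 : ∀ l, ∑ k, ψ (e 1) k * ψ (e 1) k * M k l = c₁ * ψ (e 2) l - a₁ * ψ (e 0) l := by
    intro l
    have hsq : evolMul !![0, a₁, -b₁; -a₁, 0, c₁; b₁, -c₁, 0] (e 1) (e 1) =
        c₁ • e 2 - a₁ • e 0 := by
      funext k; fin_cases k <;> simp [evolMul, he, Fin.sum_univ_three]
    have h := hψ (e 1) (e 1)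
    rw [hsq] at h
    simpa [evolMul] using (congrFun h l).symm
  have h2 : ∀ l, ∑ k, ψ (e 2) k * ψ (e 2) k * M k l = b₁ * ψ (e 0) l - c₁ * ψ (e 1) l := by
    intro l
    have hsq : evolMul !![0, a₁, -b₁; -a₁, 0, c₁; b₁, -c₁, 0] (e 2) (e 2) =
        b₁ • e 0 - c₁ • e 1 := by
      funext k; fin_cases k <;> simp [evolMul, he, Fin.sum_univ_three]
    have h := hψ (e 2) (e 2)
    rw [hsq] at h
    simpa [evolMul] using (congrFun h l).symm
  by_cases hover : ∃ i j k, i ≠ j ∧ ψ (e i) k * ψ (e j) k ≠ 0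
  · obtain ⟨i, j, k, hij, hk⟩ := hover
    obtain ⟨m, hmi, hmj⟩ : ∃ m : Fin 3, i ≠ m ∧ j ≠ m := by
      clear hk; revert i j; decide
    have hpos := mul_pos_of_overlap (w := w) (by simp [Fin.forall_fin_succ, hw, ha, hb, hc])
      (hprod i j hij) (hprod i m hmi) (hprod j m hmj) (hne m) hk
    exact ⟨hpos 2 1, hpos 1 0⟩
  push Not at hover
  have hsupp : ∀ i j k, i ≠ j → ψ (e i) k ≠ 0 → ψ (e j) k = 0 := fun i j k hij hk =>
    (mul_eq_zero.1 (hover i j k hij)).resolve_left hk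
  have hex : ∀ i, ∃ k, ψ (e i) k ≠ 0 := fun i => Function.ne_iff.1 (hne i)
  choose κ hκ using hex
  have hκinj : Function.Injective κ := by
    intro i j hij
    by_contra hne'
    exact hκ j (hij ▸ hsupp i j (κ i) hne' (hκ i))
  have hsum : ∀ i l, ∑ k, ψ (e i) k * ψ (e i) k * M k l = ψ (e i) (κ i) ^ 2 * M (κ i) l := by
    intro i l
    rw [Finset.sum_eq_single (κ i), sq]
    · intro k _ hk
      obtain ⟨j, rfl⟩ := Finite.surjective_of_injective hκinj k
      rw [hsupp j i _ (fun h => hk (h ▸ rfl)) (hκ j)]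
      simp
    · simp
  have hs : ∀ i j, i ≠ j → ψ (e i) (κ j) = 0 := fun i j hij => hsupp j i _ hij.symm (hκ j)
  have e1 := h1 (κ 0)
  have e2 := h2 (κ 0)
  have e3 := h0 (κ 2)
  have e4 := h1 (κ 2)
  rw [hsum, hs 2 0 (by decide)] at e1
  rw [hsum, hs 1 0 (by decide)] at e2
  rw [hsum, hs 1 2 (by decide)] at e3
  rw [hsum, hs 0 2 (by decide)] at e4
  have k1 : 0 < -M (κ 1) (κ 0) * M (κ 2) (κ 0) :=
    mul_pos_of_sq_mul_eq (ψ (e 1) (κ 1)) (ψ (e 2) (κ 2)) hab (hκ 0) (by linarith) (by linarith)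
  have k2 : 0 < -M (κ 0) (κ 2) * M (κ 1) (κ 2) :=
    mul_pos_of_sq_mul_eq (ψ (e 0) (κ 0)) (ψ (e 1) (κ 1)) hbc (hκ 2) (by linarith) (by linarith)
  have d01 : κ 0 ≠ κ 1 := hκinj.ne (by decide)
  have d12 : κ 1 ≠ κ 2 := hκinj.ne (by decide)
  have d02 : κ 0 ≠ κ 2 := hκinj.ne (by decide)
  have sign_trans : ∀ {p q r : ℝ}, 0 < p * q → 0 < p * r → 0 < q * r := by
    intro p q r h h'
    refine pos_of_mul_pos_right (a := p ^ 2) ?_ (sq_nonneg p)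
    linarith [mul_pos h h']
  generalize κ 0 = i at k1 k2 d01 d02
  generalize κ 1 = j at k1 k2 d01 d12
  generalize κ 2 = k at k1 k2 d12 d02
  have done₁ : 0 < a₂ * b₂ → 0 < b₂ * c₂ → 0 < a₂ * b₂ ∧ 0 < b₂ * c₂ := And.intro
  have done₂ : 0 < a₂ * b₂ → 0 < a₂ * c₂ → 0 < a₂ * b₂ ∧ 0 < b₂ * c₂ := fun h h' =>
    ⟨h, sign_trans h h'⟩
  have done₃ : 0 < c₂ * b₂ → 0 < c₂ * a₂ → 0 < a₂ * b₂ ∧ 0 < b₂ * c₂ := fun h h' =>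
    ⟨sign_trans h' h, by linarith⟩
  fin_cases i <;> fin_cases j <;> fin_cases k <;> simp [hM] at d01 d12 d02 k1 k2 <;>
  first
    | exact done₁ (by linarith) (by linarith)
    | exact done₂ (by linarith) (by linarith)
    | exact done₃ (by linarith) (by linarith)


/-- if the 3-dimensional Volterra evolution algebras with structural matrices
`A₁ = [[0,a₁,−b₁],[−a₁,0,c₁],[b₁,−c₁,0]]` and `A₂ = [[0,a₂,−b₂],[−a₂,0,c₂],[b₂,−c₂,0]]`
(entries in `[−1,1]`, `a₂b₂c₂ ≠ 0`, and `a₁,b₁,c₁` nonzero of the same sign) are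
isomorphic, then neither associated Volterra QSO on `S²` is ergodic. -/
theorem isomorphic_volterra_algebras_nonergodic_qso
    (a₁ b₁ c₁ a₂ b₂ c₂ : ℝ)
    (ha₁ : |a₁| ≤ 1) (hb₁ : |b₁| ≤ 1) (hc₁ : |c₁| ≤ 1)
    (ha₂ : |a₂| ≤ 1) (hb₂ : |b₂| ≤ 1) (hc₂ : |c₂| ≤ 1)
    (h₂ : a₂ * b₂ * c₂ ≠ 0)
    (hsign : (0 < a₁ ∧ 0 < b₁ ∧ 0 < c₁) ∨ (a₁ < 0 ∧ b₁ < 0 ∧ c₁ < 0))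
    (hiso : ∃ ψ : (Fin 3 → ℝ) ≃ₗ[ℝ] (Fin 3 → ℝ),
      ∀ x y : Fin 3 → ℝ,
        ψ (evolMul !![0, a₁, -b₁; -a₁, 0, c₁; b₁, -c₁, 0] x y) =
          evolMul !![0, a₂, -b₂; -a₂, 0, c₂; b₂, -c₂, 0] (ψ x) (ψ y)) :
    ¬ IsErgodic (volterraQSO !![0, a₁, -b₁; -a₁, 0, c₁; b₁, -c₁, 0]) ∧
    ¬ IsErgodic (volterraQSO !![0, a₂, -b₂; -a₂, 0, c₂; b₂, -c₂, 0]) := by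
  obtain ⟨ψ, hψ⟩ := hiso
  rw [abs_le] at ha₁ hb₁ hc₁ ha₂ hb₂ hc₂
  have hsigns : 0 < a₂ * b₂ ∧ 0 < b₂ * c₂ := by
    rcases hsign with ⟨ha, hb, hc⟩ | ⟨ha, hb, hc⟩
    · exact sign_pattern_of_iso h₂ (mul_pos ha hb) (mul_pos hb hc) ψ hψ
    · exact sign_pattern_of_iso h₂ (mul_pos_of_neg_of_neg ha hb) (mul_pos_of_neg_of_neg hb hc) ψ hψ
  constructor
  · rcases hsign with ⟨ha, hb, hc⟩ | ⟨ha, hb, hc⟩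
    · exact not_isErgodic_volterraQSO_of_pos ha hb hc ha₁.2 hb₁.2 hc₁.2
    · exact not_isErgodic_volterraQSO_of_neg ha hb hc ha₁.1 hb₁.1 hc₁.1
  · obtain ⟨hab, hbc⟩ := hsigns
    rcases pos_and_pos_or_neg_and_neg_of_mul_pos hab with ⟨ha, hb⟩ | ⟨ha, hb⟩
    · exact not_isErgodic_volterraQSO_of_pos ha hb (pos_of_mul_pos_right hbc hb.le)
        ha₂.2 hb₂.2 hc₂.2
    · exact not_isErgodic_volterraQSO_of_neg ha hb (neg_of_mul_pos_right hbc hb.le)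
        ha₂.1 hb₂.1 hc₂.1
end

section
/- Let E_1 and E_2 be n-dimensional Volterra evolution algebras over ℝ with skew-symmetric structural matrices A = (a_{ij}) and B = (b_{ij}) satisfying a_{ij} ≠ 0 and b_{ij} ≠ 0 for all i ≠ j, and let Γ_1, Γ_2 be the weighted graphs attached to E_1, E_2 relative to their natural bases. Then Γ_1 ≅^w Γ_2 if and only if E_1 ≅ E_2. -/
open Matrix

/-- Two weighted graphs (given by weight functions `w₁`, `w₂` on their vertex sets) are
`w`-isomorphic: there is a bijection `π` of the vertex sets such that `w₁(i,j) ≠ 0` iff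
`w₂(π i, π j) ≠ 0`, and all ratios `w₁(i,j)/w₂(π i, π j)` over pairs of nonzero weights
coincide. -/
def WIso {n m : ℕ} (w₁ : Fin n → Fin n → ℝ) (w₂ : Fin m → Fin m → ℝ) : Prop :=
  ∃ π : Fin n ≃ Fin m,
    (∀ i j, w₁ i j ≠ 0 ↔ w₂ (π i) (π j) ≠ 0) ∧
    ∀ i j l m', w₁ i j ≠ 0 → w₁ l m' ≠ 0 →
      w₁ i j / w₂ (π i) (π j) = w₁ l m' / w₂ (π l) (π m')

theorem Matrix.diag_eq_zero_of_transpose_eq_neg {n : ℕ} {A : Matrix (Fin n) (Fin n) ℝ}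
    (hA : Aᵀ = -A) (i : Fin n) : A i i = 0 := by
  have h := congrFun (congrFun hA i) i
  simp only [transpose_apply, neg_apply] at h
  linarith

/-- A `w`-isomorphism scales all weights by a common nonzero factor. -/
theorem WIso.exists_scale {n m : ℕ} {w₁ : Fin n → Fin n → ℝ} {w₂ : Fin m → Fin m → ℝ}
    (h : WIso w₁ w₂) :
    ∃ (π : Fin n ≃ Fin m) (c : ℝ), c ≠ 0 ∧ ∀ i j, w₁ i j = c * w₂ (π i) (π j) := by
  obtain ⟨π, hsupp, hratio⟩ := h
  have hzero : ∀ i j, w₁ i j = 0 → w₂ (π i) (π j) = 0 := fun i j h0 => by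
    by_contra hne
    exact (hsupp i j).2 hne h0
  by_cases hex : ∃ i j, w₁ i j ≠ 0
  · obtain ⟨a, b, hab⟩ := hex
    refine ⟨π, w₁ a b / w₂ (π a) (π b), div_ne_zero hab ((hsupp a b).1 hab), fun i j => ?_⟩
    by_cases hij : w₁ i j = 0
    · rw [hzero i j hij, hij, mul_zero]
    · rw [← hratio i j a b hij hab, div_mul_cancel₀ _ ((hsupp i j).1 hij)]
  · push Not at hex
    exact ⟨π, 1, one_ne_zero, fun i j => by rw [hzero i j (hex i j), hex i j, mul_zero]⟩

theorem WIso.of_scale {n m : ℕ} {w₁ : Fin n → Fin n → ℝ} {w₂ : Fin m → Fin m → ℝ}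
    (π : Fin n ≃ Fin m) (c : ℝ) (hc : c ≠ 0) (h : ∀ i j, w₁ i j = c * w₂ (π i) (π j)) :
    WIso w₁ w₂ := by
  have hratio : ∀ i j, w₁ i j ≠ 0 → w₁ i j / w₂ (π i) (π j) = c := fun i j hij => by
    rw [h i j] at hij ⊢
    exact mul_div_cancel_right₀ c (right_ne_zero_of_mul hij)
  refine ⟨π, fun i j => ?_, fun i j l m' hij hlm => by rw [hratio i j hij, hratio l m' hlm]⟩
  rw [h i j]
  simp [hc]

/-- Rescaling a structural matrix and permuting the natural basis gives an isomorphic algebra. -/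
theorem exists_evolMul_equiv_of_scale {n : ℕ} {A B : Matrix (Fin n) (Fin n) ℝ}
    (π : Fin n ≃ Fin n) {c : ℝ} (hc : c ≠ 0) (h : ∀ i j, A i j = c * B (π i) (π j)) :
    ∃ ψ : (Fin n → ℝ) ≃ₗ[ℝ] (Fin n → ℝ),
      ∀ x y : Fin n → ℝ, ψ (evolMul A x y) = evolMul B (ψ x) (ψ y) := by
  refine ⟨(LinearEquiv.funCongrLeft ℝ ℝ π.symm).trans
    (LinearEquiv.smulOfNeZero ℝ (Fin n → ℝ) c hc), fun x y => ?_⟩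
  ext k
  simp only [evolMul, LinearEquiv.trans_apply, LinearEquiv.smulOfNeZero_apply, Pi.smul_apply,
    LinearEquiv.funCongrLeft_apply, LinearMap.funLeft_apply, smul_eq_mul]
  rw [Finset.mul_sum, ← Equiv.sum_comp π (fun i => c * x (π.symm i) * (c * y (π.symm i)) * B i k)]
  refine Finset.sum_congr rfl fun i _ => ?_
  simp only [h, Equiv.symm_apply_apply, Equiv.apply_symm_apply]
  ring

/-- The coordinate matrix of an isomorphism of Volterra evolution algebras and its inverse are
linked through a skew-symmetric matrix `S`. -/
theorem exists_skew_mul_eq_mul {n : ℕ} {A B P : Matrix (Fin n) (Fin n) ℝ}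
    (hB : Bᵀ = -B) (hP : IsUnit P.det)
    (hsq : ∀ i k, (A * P) i k = ∑ m, P i m * P i m * B m k)
    (horth : ∀ i j, i ≠ j → ∀ k, ∑ m, P i m * P j m * B m k = 0) :
    ∃ S : Matrix (Fin n) (Fin n) ℝ, (∀ i j, S i j = -S j i) ∧
      ∀ i j m, (A * P) i m * P j m = S i j * P⁻¹ m j := by
  have hskew : ∀ u v : Fin n → ℝ, (u ᵥ* B) ⬝ᵥ v = -((v ᵥ* B) ⬝ᵥ u) := fun u v => by
    rw [← dotProduct_mulVec, ← dotProduct_mulVec, dotProduct_comm, ← vecMul_transpose, hB,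
      vecMul_neg, neg_dotProduct, ← dotProduct_mulVec]
  have hrow : ∀ i, (A * P) i = (P i * P i) ᵥ* B := fun i => by
    ext k
    simp [hsq, vecMul, dotProduct]
  have hker : ∀ i j, i ≠ j → (P i * P j) ᵥ* B = 0 := fun i j hij => by
    ext k
    simpa [vecMul, dotProduct] using horth i j hij k
  refine ⟨of fun i j => ((P i * P i) ᵥ* B) ⬝ᵥ (P j * P j), fun i j => ?_, fun i j m => ?_⟩
  · exact hskew _ _
  · set s := ((P i * P i) ᵥ* B) ⬝ᵥ (P j * P j) with hs
    have key : P *ᵥ ((A * P) i * P j) = Pi.single j s := by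
      ext l
      have h1 : (P *ᵥ ((A * P) i * P j)) l = ((P i * P i) ᵥ* B) ⬝ᵥ (P j * P l) := by
        rw [hrow]
        simp only [mulVec, dotProduct, Pi.mul_apply]
        exact Finset.sum_congr rfl fun _ _ => by ring
      rw [h1]
      by_cases hl : l = j
      · subst hl
        simp [hs]
      · rw [hskew, hker j l (Ne.symm hl)]
        simp [hl]
    have h2 := congrArg (P⁻¹ *ᵥ ·) key
    simp only [mulVec_mulVec, nonsing_inv_mul P hP, one_mulVec] at h2
    have h3 := congrFun h2 m
    simp only [Pi.mul_apply, mulVec_single, Pi.smul_apply, MulOpposite.smul_eq_mul_unop,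
      MulOpposite.unop_op, col_apply] at h3
    rw [h3]
    simp [mul_comm, hs]

/-- The columns of an invertible matrix are nonzero. -/
theorem Matrix.exists_col_ne_zero {n : ℕ} {P : Matrix (Fin n) (Fin n) ℝ} (hP : IsUnit P.det)
    (m : Fin n) : ∃ i, P i m ≠ 0 := by
  by_contra! h
  have h1 := congrFun (congrFun (nonsing_inv_mul P hP) m) m
  simp [mul_apply, h] at h1

/-- The rows of an invertible matrix are nonzero. -/
theorem Matrix.exists_row_ne_zero {n : ℕ} {P : Matrix (Fin n) (Fin n) ℝ} (hP : IsUnit P.det)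
    (i : Fin n) : ∃ m, P i m ≠ 0 := by
  by_contra! h
  have h1 := congrFun (congrFun (mul_nonsing_inv P hP) i) i
  simp [mul_apply, h] at h1

/-- Each column of the coordinate matrix of an isomorphism of Volterra evolution algebras has at
most one nonzero entry. -/
theorem eq_of_apply_ne_zero {n : ℕ} [Nontrivial (Fin n)] {A P S : Matrix (Fin n) (Fin n) ℝ}
    (hA : ∀ i j, i ≠ j → A i j ≠ 0) (hP : IsUnit P.det) (hS : ∀ i j, S i j = -S j i)
    (hSP : ∀ i j m, (A * P) i m * P j m = S i j * P⁻¹ m j)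
    {j l m : Fin n} (hj : P j m ≠ 0) (hl : P l m ≠ 0) : j = l := by
  have hA_eq : ∀ i j, A i j = ∑ m, (A * P) i m * P⁻¹ m j := fun i j => by
    rw [← mul_apply, mul_nonsing_inv_cancel_right _ _ hP]
  have hcol : ∀ j, ∃ i, S i j ≠ 0 := by
    intro j
    by_contra! h
    obtain ⟨k, hk⟩ := exists_ne j
    refine hA j k hk.symm ?_
    rw [hA_eq]
    refine Finset.sum_eq_zero fun m _ => ?_
    obtain ⟨i, hi⟩ := exists_col_ne_zero hP m
    have h1 := hSP j i m
    rw [hS j i, h i, neg_zero, zero_mul] at h1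
    rw [(mul_eq_zero.1 h1).resolve_right hi, zero_mul]
  have hinv : ∀ j m, P j m = 0 → P⁻¹ m j = 0 := fun j m h => by
    obtain ⟨i, hi⟩ := hcol j
    have h1 := hSP i j m
    rw [h, mul_zero] at h1
    exact (mul_eq_zero.1 h1.symm).resolve_left hi
  have hprop : ∀ i j, A i j = S i j * ∑ m, P⁻¹ m j * P⁻¹ m j / P j m := fun i j => by
    rw [hA_eq, Finset.mul_sum]
    refine Finset.sum_congr rfl fun m _ => ?_
    by_cases h : P j m = 0
    · simp [hinv j m h]
    · field_simp
      linear_combination P⁻¹ m j * hSP i j m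
  by_contra hne
  have hSlj : S l j ≠ 0 := fun h => hA l j (Ne.symm hne) (by rw [hprop, h, zero_mul])
  have hSll : S l l = 0 := by linarith [hS l l]
  have hRl : (A * P) l m = 0 := by
    have h1 := hSP l l m
    rw [hSll, zero_mul] at h1
    exact (mul_eq_zero.1 h1).resolve_right hl
  have hq : P⁻¹ m j = 0 := by
    have h1 := hSP l j m
    rw [hRl, zero_mul] at h1
    exact (mul_eq_zero.1 h1.symm).resolve_left hSlj
  have hR : ∀ i, (A * P) i m = 0 := fun i => by
    have h1 := hSP i j m
    rw [hq, mul_zero] at h1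
    exact (mul_eq_zero.1 h1).resolve_right hj
  obtain ⟨k, hk⟩ : ∃ k, P⁻¹ m k ≠ 0 := exists_row_ne_zero (isUnit_nonsing_inv_det P hP) m
  obtain ⟨i, hi⟩ := hcol k
  have h1 := hSP i k m
  rw [hR, zero_mul] at h1
  exact mul_ne_zero hi hk h1.symm

/-- An invertible matrix whose columns have at most one nonzero entry is monomial. -/
theorem Matrix.exists_perm_of_col_unique {n : ℕ} {P : Matrix (Fin n) (Fin n) ℝ}
    (hP : IsUnit P.det) (huniq : ∀ {j l m : Fin n}, P j m ≠ 0 → P l m ≠ 0 → j = l) :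
    ∃ π : Fin n ≃ Fin n, (∀ i, P i (π i) ≠ 0) ∧ ∀ i m, m ≠ π i → P i m = 0 := by
  choose σ hσ using exists_col_ne_zero hP
  have hsurj : Function.Surjective σ := fun i => by
    obtain ⟨m, hm⟩ := exists_row_ne_zero hP i
    exact ⟨m, huniq (hσ m) hm⟩
  let e := Equiv.ofBijective σ (Finite.surjective_iff_bijective.1 hsurj)
  refine ⟨e.symm, fun i => ?_, fun i m hm => ?_⟩
  · have h := hσ (e.symm i)
    rwa [show σ (e.symm i) = i from e.apply_symm_apply i] at h
  · by_contra h
    exact hm (e.eq_symm_apply.2 (huniq (hσ m) h))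

/-- A monomial isomorphism of Volterra evolution algebras with nonzero off-diagonal structure
constants is a multiple of a permutation of the natural bases. -/
theorem exists_scale_of_monomial {n : ℕ} [Nonempty (Fin n)] {A B P : Matrix (Fin n) (Fin n) ℝ}
    (hAskew : Aᵀ = -A) (hBskew : Bᵀ = -B) (hB : ∀ i j, i ≠ j → B i j ≠ 0)
    (hsq : ∀ i k, (A * P) i k = ∑ m, P i m * P i m * B m k) (π : Fin n ≃ Fin n)
    (hπ : ∀ i, P i (π i) ≠ 0) (hoff : ∀ i m, m ≠ π i → P i m = 0) :
    ∃ c : ℝ, c ≠ 0 ∧ ∀ i j, A i j = c * B (π i) (π j) := by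
  have hentry : ∀ i j, A i j * P j (π j) = P i (π i) ^ 2 * B (π i) (π j) := fun i j => by
    have h := hsq i (π j)
    rw [mul_apply, Finset.sum_eq_single j, Finset.sum_eq_single (π i)] at h
    · rw [h]; ring
    · intro m _ hm
      simp [hoff i m hm]
    · simp
    · intro k _ hk
      rw [hoff k (π j) (fun h => hk (π.injective h).symm), mul_zero]
    · simp
  have hAs : ∀ i j, A j i = -A i j := fun i j => congrFun (congrFun hAskew i) j
  have hBs : ∀ i j, B j i = -B i j := fun i j => congrFun (congrFun hBskew i) j
  have hconst : ∀ i j, P i (π i) = P j (π j) := fun i j => by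
    by_cases hij : i = j
    · rw [hij]
    · have hBne := hB (π i) (π j) (π.injective.ne hij)
      have h2 := hentry j i
      rw [hAs i j, hBs (π i) (π j)] at h2
      have h3 : B (π i) (π j) * (P i (π i) ^ 3 - P j (π j) ^ 3) = 0 := by
        linear_combination -P j (π j) * h2 - P i (π i) * hentry i j
      have h4 : P i (π i) ^ 3 = P j (π j) ^ 3 :=
        sub_eq_zero.1 ((mul_eq_zero.1 h3).resolve_left hBne)
      exact (Odd.strictMono_pow (by decide : Odd 3)).injective h4
  obtain ⟨a⟩ := ‹Nonempty (Fin n)›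
  refine ⟨P a (π a), hπ a, fun i j => mul_right_cancel₀ (hπ a) ?_⟩
  have h := hentry i j
  rw [hconst i a, hconst j a] at h
  rw [h]
  ring

/-- for two `n`-dimensional real Volterra evolution algebras with
skew-symmetric structural matrices `A`, `B` whose off-diagonal entries are all nonzero,
the attached weighted graphs are `w`-isomorphic iff the algebras are isomorphic. -/
theorem weighted_graphs_wIso_iff_volterra_isomorphic
    {n : ℕ} (A B : Matrix (Fin n) (Fin n) ℝ)
    (hAskew : Aᵀ = -A) (hBskew : Bᵀ = -B)
    (hA : ∀ i j : Fin n, i ≠ j → A i j ≠ 0) (hB : ∀ i j : Fin n, i ≠ j → B i j ≠ 0) :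
    WIso (fun i j => A i j) (fun i j => B i j) ↔
    (∃ ψ : (Fin n → ℝ) ≃ₗ[ℝ] (Fin n → ℝ),
        ∀ x y : Fin n → ℝ, ψ (evolMul A x y) = evolMul B (ψ x) (ψ y)) := by
  constructor
  · intro h
    obtain ⟨π, c, hc, hscale⟩ := h.exists_scale
    exact exists_evolMul_equiv_of_scale π hc hscale
  · rintro ⟨ψ, hψ⟩
    rcases subsingleton_or_nontrivial (Fin n) with hn | hn
    · refine WIso.of_scale (Equiv.refl _) 1 one_ne_zero fun i j => ?_
      rw [Subsingleton.elim j i]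
      simp [diag_eq_zero_of_transpose_eq_neg hAskew, diag_eq_zero_of_transpose_eq_neg hBskew]
    · let P : Matrix (Fin n) (Fin n) ℝ := (LinearMap.toMatrix' ψ.toLinearMap)ᵀ
      have hPdet : IsUnit P.det := by
        rw [det_transpose, LinearMap.det_toMatrix']
        exact ψ.isUnit_det'
      have hPapp : ∀ i, ψ (Pi.single i 1) = P i := fun i => by
        ext k
        simp [P, LinearMap.toMatrix'_apply]
      have hψP : ∀ x, ψ x = x ᵥ* P := fun x => by
        simp [P, vecMul_transpose, ← Matrix.toLin'_apply]
      have hsq : ∀ i k, (A * P) i k = ∑ m, P i m * P i m * B m k := fun i k => by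
        have h := congrFun (hψ (Pi.single i 1) (Pi.single i 1)) k
        have h1 : evolMul A (Pi.single i 1) (Pi.single i 1) = A i := by
          ext k
          simp [evolMul, Pi.single_apply]
        rw [h1, hPapp, hψP] at h
        exact h
      have horth : ∀ i j, i ≠ j → ∀ k, ∑ m, P i m * P j m * B m k = 0 := fun i j hij k => by
        have h := congrFun (hψ (Pi.single i 1) (Pi.single j 1)) k
        have h1 : evolMul A (Pi.single i 1) (Pi.single j 1) = 0 := by
          ext k
          simp [evolMul, Pi.single_apply, hij.symm]
        rw [h1, hPapp, hPapp, map_zero] at h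
        exact h.symm
      obtain ⟨S, hS, hSP⟩ := exists_skew_mul_eq_mul hBskew hPdet hsq horth
      obtain ⟨π, hπ, hoff⟩ := exists_perm_of_col_unique hPdet
        (fun hj hl => eq_of_apply_ne_zero hA hPdet hS hSP hj hl)
      obtain ⟨c, hc, hscale⟩ := exists_scale_of_monomial hAskew hBskew hB hsq π hπ hoff
      exact WIso.of_scale π c hc hscale
end
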